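/- Let I and O be disjoint finite sets of signals, H ⊆ I∪O, and let L_φ, L_ψ ⊆ (2^(I∪O))^ω each be recognized by some deterministic parity word automaton. Then there exists a deterministic parity word automaton D over the alphabet 2^(I∪O) that accepts a word w ∈ (2^(I∪O))^ω if and only if w ∈ L_φ and there exist w⁺, w⁻ ∈ noise_H(w) with w⁺ ∈ L_φ ∩ L_ψ and w⁻ ∈ L_φ ∖ L_ψ. -/

import Mathlib

open Set

/-- Infinite words over alphabet `A`. -/
abbrev Word (A : Type) := ℕ → A

/-- `noiseW H w`: all words that agree with `w` on the visible signals `Hᶜ`. -/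
def noiseW {A : Type} (H : Set A) (w : Word (Set A)) : Set (Word (Set A)) :=
  {w' | ∀ j, w' j ∩ Hᶜ = w j ∩ Hᶜ}

/-- The set of states occurring infinitely often in `r`. -/
def infOcc {Q : Type} (r : Word Q) : Set Q := {q | ∀ N, ∃ n ≥ N, r n = q}

/-- A deterministic parity word automaton with alphabet `A` and state set `Q`
(partial transition function, ranking into the naturals). -/
structure DPW (A Q : Type) where
  q0 : Q
  δ : Q → A → Option Q
  rank : Q → ℕ

/-- `r` is the run of `D` on `w` (when it exists). -/
def DPW.IsRun {A Q : Type} (D : DPW A Q) (r : Word Q) (w : Word A) : Prop :=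
  r 0 = D.q0 ∧ ∀ j, D.δ (r j) (w j) = some (r (j + 1))

/-- The language of a DPW: words whose run exists and in which the maximal rank
occurring infinitely often is even. -/
def DPW.lang {A Q : Type} (D : DPW A Q) : Set (Word A) :=
  {w | ∃ r, D.IsRun r w ∧ Even (sSup (D.rank '' infOcc r))}

open Filter

/-- The run of a total deterministic transition function. -/
def mrun {A Q : Type} (step : Q → A → Q) (q0 : Q) (w : Word A) : ℕ → Q
  | 0 => q0
  | n + 1 => step (mrun step q0 w n) (w n)

/-- Languages recognised by finite deterministic Muller automata. -/
def Reg {A : Type} (L : Set (Word A)) : Prop :=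
  ∃ (Q : Type) (_ : Finite Q) (q0 : Q) (step : Q → A → Q) (F : Set Q → Prop),
    ∀ w, w ∈ L ↔ F (infOcc (mrun step q0 w))

lemma exists_infOcc {Q : Type} [Finite Q] (r : Word Q) (P : Q → Prop)
    (h : ∀ N, ∃ n ≥ N, P (r n)) : ∃ q ∈ infOcc r, P q := by
  by_contra hc
  push Not at hc
  have h1 : ∀ q, ∀ᶠ n in atTop, P q → r n ≠ q := by
    intro q
    by_cases hq : q ∈ infOcc r
    · exact Eventually.of_forall fun n hP => absurd hP (hc q hq)
    · simp only [infOcc, mem_ofPred_eq, not_forall, not_exists, not_and] at hq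
      obtain ⟨N, hN⟩ := hq
      filter_upwards [eventually_ge_atTop N] with n hn _
      exact hN n hn
  rw [← eventually_all] at h1
  obtain ⟨N, hN⟩ := eventually_atTop.1 h1
  obtain ⟨n, hn, hP⟩ := h N
  exact hN n hn (r n) hP rfl

lemma infOcc_comp {Q R : Type} [Finite Q] (r : Word Q) (f : Q → R) :
    infOcc (fun n => f (r n)) = f '' infOcc r := by
  ext x
  constructor
  · intro h
    obtain ⟨q, hq, hx⟩ := exists_infOcc r (fun q => f q = x) h
    exact ⟨q, hq, hx⟩
  · rintro ⟨q, hq, rfl⟩ N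
    obtain ⟨n, hn, h⟩ := hq N
    exact ⟨n, hn, by simp [h]⟩

lemma eventually_infOcc {Q : Type} [Finite Q] (r : Word Q) :
    ∃ N, ∀ n ≥ N, r n ∈ infOcc r := by
  by_contra hc
  push Not at hc
  obtain ⟨q, hq, h⟩ := exists_infOcc r (fun q => q ∉ infOcc r) hc
  exact h hq

lemma reg_of_dpw {A Q : Type} [Finite Q] (D : DPW A Q) : Reg D.lang := by
  refine ⟨Option Q, inferInstance, some D.q0, fun o a => o.bind fun q => D.δ q a,
    fun S => none ∉ S ∧ Even (sSup (D.rank '' {q | some q ∈ S})), fun w => ?_⟩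
  set ρ := mrun (fun (o : Option Q) a => o.bind fun q => D.δ q a) (some D.q0) w with hρ
  have key : ∀ r : Word Q, ρ = (fun n => some (r n)) →
      none ∉ infOcc ρ ∧ {q | some q ∈ infOcc ρ} = infOcc r := by
    intro r hr
    rw [hr]
    constructor
    · intro h
      obtain ⟨n, _, hn⟩ := h 0
      simp at hn
    · ext q
      simp [infOcc]
  constructor
  · rintro ⟨r, ⟨h0, h1⟩, hr⟩
    have : ρ = fun n => some (r n) := by
      funext n
      induction n with
      | zero => simp [hρ, mrun, h0]
      | succ n ih =>
        have : ρ (n + 1) = (ρ n).bind fun q => D.δ q (w n) := rfl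
        rw [this, ih]
        simp [h1]
    obtain ⟨ha, hb⟩ := key r this
    exact ⟨ha, by rw [hb]; exact hr⟩
  · rintro ⟨ha, hb⟩
    have hne : ∀ n, ∃ q, ρ n = some q := by
      intro n
      by_contra hc
      have hn : ρ n = none := by
        cases h : ρ n with
        | none => rfl
        | some q => exact absurd ⟨q, h⟩ hc
      apply ha
      intro N
      have : ∀ k, ρ (n + k) = none := by
        intro k
        induction k with
        | zero => exact hn
        | succ k ih =>
          have : ρ (n + k + 1) = (ρ (n + k)).bind fun q => D.δ q (w (n + k)) := rfl
          rw [← add_assoc, this, ih]; rfl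
      exact ⟨n + N, by omega, this N⟩
    choose r hr using hne
    have hr' : ρ = fun n => some (r n) := funext hr
    obtain ⟨hc, hd⟩ := key r hr'
    refine ⟨r, ⟨?_, ?_⟩, by rw [← hd]; exact hb⟩
    · have := hr 0
      simp only [hρ, mrun] at this
      exact (Option.some.inj this).symm
    · intro j
      have : ρ (j + 1) = (ρ j).bind fun q => D.δ q (w j) := rfl
      rw [hr, hr] at this
      exact this.symm

/-- Transition function of the latest appearance record automaton. -/
def larStep {A Q : Type} (step : Q → A → Q) (x : Q × (Q → Set Q)) (a : A) :
    Q × (Q → Set Q) :=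
  (step x.1 a, fun b => {p | b ≠ x.1 ∧ (p = x.1 ∨ p ∈ x.2 b)})

/-- The set recorded by a state. -/
def larSet {Q : Type} (x : Q × (Q → Set Q)) : Set Q := insert x.1 (x.2 x.1)

open Classical in
/-- Rank of a latest appearance record. -/
noncomputable def larRank {Q : Type} (F : Set Q → Prop) (x : Q × (Q → Set Q)) : ℕ :=
  2 * (larSet x).ncard + if F (larSet x) then 0 else 1

lemma lar_fst {A Q : Type} (step : Q → A → Q) (q0 : Q) (w : Word A) (n : ℕ) :
    (mrun (larStep step) (q0, fun _ => ∅) w n).1 = mrun step q0 w n := by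
  induction n with
  | zero => rfl
  | succ n ih => simp only [mrun, larStep, ih]

lemma lar_snd {A Q : Type} (step : Q → A → Q) (q0 : Q) (w : Word A) (n : ℕ) (p b : Q) :
    p ∈ (mrun (larStep step) (q0, fun _ => ∅) w n).2 b ↔
      ∃ s < n, mrun step q0 w s = p ∧ ∀ s', s ≤ s' → s' < n → mrun step q0 w s' ≠ b := by
  induction n with
  | zero => simp [mrun]
  | succ n ih =>
    have h1 : p ∈ (mrun (larStep step) (q0, fun _ => ∅) w (n + 1)).2 b ↔
      b ≠ mrun step q0 w n ∧ (p = mrun step q0 w n ∨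
        p ∈ (mrun (larStep step) (q0, fun _ => ∅) w n).2 b) := by
      rw [← lar_fst step q0 w n]; rfl
    rw [h1, ih]
    constructor
    · rintro ⟨hb, rfl | ⟨s, hs, hp, hs'⟩⟩
      · refine ⟨n, by omega, rfl, fun s' h h' => ?_⟩
        obtain rfl : s' = n := by omega
        exact hb.symm
      · refine ⟨s, by omega, hp, fun s' h h' => ?_⟩
        rcases Nat.lt_succ_iff_lt_or_eq.1 h' with h2 | rfl
        · exact hs' s' h h2
        · exact hb.symm
    · rintro ⟨s, hs, hp, hs'⟩
      refine ⟨(hs' n (by omega) (by omega)).symm, ?_⟩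
      rcases Nat.lt_succ_iff_lt_or_eq.1 hs with h2 | rfl
      · exact Or.inr ⟨s, h2, hp, fun s' h h' => hs' s' h (by omega)⟩
      · exact Or.inl hp.symm

lemma dpw_of_reg {A : Type} {L : Set (Word A)} (hL : Reg L) :
    ∃ (Q : Type) (_ : Fintype Q) (D : DPW A Q), D.lang = L := by
  classical
  obtain ⟨Q, _, q0, step, F, hF⟩ := hL
  refine ⟨Q × (Q → Set Q), Fintype.ofFinite _,
    ⟨(q0, fun _ => ∅), fun x a => some (larStep step x a), larRank F⟩, ?_⟩
  ext w
  rw [hF]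
  set r := mrun step q0 w with hr
  set ρ := mrun (larStep step) (q0, fun _ => ∅) w with hρ
  have hrun : ∀ r', DPW.IsRun ⟨(q0, fun _ => ∅), fun x a => some (larStep step x a), larRank F⟩
      r' w ↔ r' = ρ := by
    intro r'
    constructor
    · rintro ⟨h0, h1⟩
      funext n
      induction n with
      | zero => exact h0
      | succ n ih =>
        have := Option.some.inj (h1 n)
        rw [← this, ih]; rfl
    · rintro rfl
      exact ⟨rfl, fun j => rfl⟩
  have hset : ∀ n p, p ∈ larSet (ρ n) ↔ p = r n ∨
      ∃ s < n, r s = p ∧ ∀ s', s ≤ s' → s' < n → r s' ≠ r n := by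
    intro n p
    unfold larSet
    rw [mem_insert_iff, lar_snd, lar_fst]
  obtain ⟨N0, hN0⟩ := eventually_infOcc r
  -- from some point on, the recorded set is contained in the infinity set
  have hsub : ∃ N, ∀ n ≥ N, larSet (ρ n) ⊆ infOcc r := by
    have h1 : ∀ q, ∃ t ≥ N0, q ∈ infOcc r → r t = q := by
      intro q
      by_cases hq : q ∈ infOcc r
      · obtain ⟨t, ht, h⟩ := hq N0
        exact ⟨t, ht, fun _ => h⟩
      · exact ⟨N0, le_rfl, fun h => absurd h hq⟩
    choose t ht1 ht2 using h1
    obtain ⟨B, hB⟩ := (Set.finite_range t).bddAbove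
    refine ⟨max N0 (B + 1), fun n hn p hp => ?_⟩
    have hn0 : N0 ≤ n := le_trans (le_max_left _ _) hn
    have hn1 : B + 1 ≤ n := le_trans (le_max_right _ _) hn
    rw [hset] at hp
    rcases hp with rfl | ⟨s, hs, rfl, hs'⟩
    · exact hN0 n hn0
    · have hb : t (r n) ≤ B := hB ⟨_, rfl⟩
      have hlt : t (r n) < s := by
        by_contra hc
        exact hs' (t (r n)) (by omega) (by omega) (ht2 _ (hN0 n hn0))
      exact hN0 s (by have := ht1 (r n); omega)
  have heq : ∀ N, ∃ n ≥ N, infOcc r ⊆ larSet (ρ n) := by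
    intro N
    have h1 : ∀ q : infOcc r, ∃ t, N ≤ t ∧ r t = q := fun q => q.2 N
    obtain ⟨q1, hq1, -⟩ := exists_infOcc r (fun _ => True) (fun N => ⟨N, le_rfl, trivial⟩)
    have : Nonempty (infOcc r) := ⟨⟨q1, hq1⟩⟩
    obtain ⟨qm, hqm⟩ := Finite.exists_max (fun q : infOcc r => Nat.find (h1 q))
    have hm := Nat.find_spec (h1 qm)
    refine ⟨Nat.find (h1 qm), hm.1, fun p hp => ?_⟩
    rw [hset]
    by_cases hpq : p = qm
    · left; rw [hm.2, hpq]
    · right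
      have hp' := Nat.find_spec (h1 ⟨p, hp⟩)
      have hle := hqm ⟨p, hp⟩
      refine ⟨Nat.find (h1 ⟨p, hp⟩), ?_, hp'.2, ?_⟩
      · rcases hle.lt_or_eq with h | h
        · exact h
        · exfalso; apply hpq
          have h2 := hp'.2
          have h3 := hm.2
          simp only at h
          rw [h] at h2
          exact h2.symm.trans h3
      · intro s' h h' hc
        exact Nat.find_min (h1 qm) h' ⟨by omega, hc.trans hm.2⟩
  obtain ⟨N1, hN1⟩ := hsub
  have hfin : (infOcc r).Finite := Set.toFinite _
  have hmax : IsGreatest (larRank F '' infOcc ρ)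
      (2 * (infOcc r).ncard + if F (infOcc r) then 0 else 1) := by
    constructor
    · obtain ⟨x, hx, hx'⟩ := exists_infOcc ρ (fun x => larSet x = infOcc r) (by
        intro N
        obtain ⟨n, hn, h⟩ := heq (max N N1)
        exact ⟨n, le_trans (le_max_left _ _) hn,
          Subset.antisymm (hN1 n (le_trans (le_max_right _ _) hn)) h⟩)
      exact ⟨x, hx, by rw [larRank, hx']⟩
    · rintro _ ⟨x, hx, rfl⟩
      obtain ⟨n, hn, rfl⟩ := hx N1
      have hs := hN1 n hn
      by_cases hc : larSet (ρ n) = infOcc r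
      · rw [larRank, hc]
      · have := Set.ncard_lt_ncard (hs.ssubset_of_ne hc) hfin
        unfold larRank
        split_ifs <;> omega
  have hsup : sSup (larRank F '' infOcc ρ) = _ := hmax.csSup_eq
  constructor
  · rintro ⟨r', hr', he⟩
    rw [hrun] at hr'
    subst hr'
    simp only at he
    rw [hsup] at he
    by_contra hc
    rw [if_neg hc] at he
    revert he
    simp [parity_simps]
  · intro h
    refine ⟨ρ, (hrun _).2 rfl, ?_⟩
    simp only
    rw [hsup, if_pos h]
    simp

lemma reg_bool {A ι : Type} [Finite ι] (L : ι → Set (Word A)) (hL : ∀ i, Reg (L i))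
    (G : Set ι → Prop) : Reg {w | G {i | w ∈ L i}} := by
  choose Q hQ q0 step F hF using hL
  refine ⟨∀ i, Q i, inferInstance, q0, fun q a i => step i (q i) a,
    fun S => G {i | F i ((fun q => q i) '' S)}, fun w => ?_⟩
  have h1 : ∀ n i, mrun (fun (q : ∀ i, Q i) a i => step i (q i) a) q0 w n i =
      mrun (step i) (q0 i) w n := by
    intro n i
    induction n with
    | zero => rfl
    | succ n ih => simp only [mrun, ih]
  have h2 : ∀ i, w ∈ L i ↔ F i ((fun q => q i) ''
      infOcc (mrun (fun (q : ∀ i, Q i) a i => step i (q i) a) q0 w)) := by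
    intro i
    rw [hF, ← infOcc_comp]
    simp only [h1]
  simp only [mem_ofPred_eq, h2]

lemma reg_comap {A B : Type} (f : A → B) {L : Set (Word B)} (hL : Reg L) :
    Reg {w : Word A | (fun n => f (w n)) ∈ L} := by
  obtain ⟨Q, hQ, q0, step, F, hF⟩ := hL
  refine ⟨Q, hQ, q0, fun q a => step q (f a), F, fun w => ?_⟩
  have : mrun (fun q a => step q (f a)) q0 w = mrun step q0 (fun n => f (w n)) := by
    funext n
    induction n with
    | zero => rfl
    | succ n ih => simp only [mrun, ih]
  rw [mem_ofPred_eq, hF, this]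

/-- Product of the factor `[i, j)` of a sequence in a monoid. -/
def prd {M : Type} [Monoid M] (m : ℕ → M) (i : ℕ) : ℕ → M
  | 0 => 1
  | j + 1 => if i ≤ j then prd m i j * m j else 1

section Mon
variable {M : Type} [Monoid M]

lemma prd_self (m : ℕ → M) (i : ℕ) : prd m i i = 1 := by
  cases i <;> simp [prd]

lemma prd_succ (m : ℕ → M) {i j : ℕ} (h : i ≤ j) : prd m i (j + 1) = prd m i j * m j := by
  simp [prd, h]

lemma prd_mul (m : ℕ → M) {i j k : ℕ} (h : i ≤ j) (h' : j ≤ k) :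
    prd m i j * prd m j k = prd m i k := by
  induction k, h' using Nat.le_induction with
  | base => simp [prd_self]
  | succ k hk ih => rw [prd_succ m hk, prd_succ m (h.trans hk), ← mul_assoc, ih]

lemma ramsey [Finite M] (m : ℕ → M) (X : Set ℕ) (hX : ∀ N, ∃ n ≥ N, n ∈ X) :
    ∃ (g : ℕ → ℕ) (f : M), StrictMono g ∧ (∀ i, g i ∈ X) ∧
      (∀ i, prd m (g i) (g (i + 1)) = f) ∧ f * f = f := by
  have hne : (atTop ⊓ 𝓟 X : Filter ℕ).NeBot := by
    rw [← frequently_mem_iff_neBot, frequently_atTop]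
    exact hX
  let U := Ultrafilter.of (atTop ⊓ 𝓟 X)
  have hU : (U : Filter ℕ) ≤ atTop ⊓ 𝓟 X := Ultrafilter.of_le _
  have hUX : ∀ᶠ n in (U : Filter ℕ), n ∈ X := hU (mem_inf_of_right (mem_principal_self X))
  have hUT : ∀ N, ∀ᶠ n in (U : Filter ℕ), N < n := fun N =>
    hU (mem_inf_of_left (eventually_gt_atTop N))
  have hcol : ∀ c : ℕ → M, ∃ x, ∀ᶠ n in (U : Filter ℕ), c n = x := by
    intro c
    obtain ⟨x, hx⟩ := Ultrafilter.eq_pure_of_finite (U.map c)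
    refine ⟨x, ?_⟩
    have : {x} ∈ U.map c := by rw [hx]; exact rfl
    exact this
  choose v hv using fun i => hcol (prd m i)
  obtain ⟨f, hf⟩ := hcol v
  obtain ⟨x0, hx0, hx0X⟩ := (hf.and hUX).exists
  have hnext : ∀ x : {x // v x = f ∧ x ∈ X}, ∃ y : {x // v x = f ∧ x ∈ X},
      x.1 < y.1 ∧ prd m x.1 y.1 = f := by
    rintro ⟨x, hx, hxX⟩
    obtain ⟨y, ⟨⟨h1, h2⟩, h3⟩, h4⟩ := (((hf.and hUX).and (hUT x)).and (hv x)).exists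
    exact ⟨⟨y, h1, h2⟩, h3, h4.trans hx⟩
  choose nx hn1 hn2 using hnext
  let g' : ℕ → {x // v x = f ∧ x ∈ X} := fun n => nx^[n] ⟨x0, hx0, hx0X⟩
  have hg' : ∀ n, g' (n + 1) = nx (g' n) := fun n => Function.iterate_succ_apply' _ _ _
  refine ⟨fun n => (g' n).1, f, strictMono_nat_of_lt_succ fun n => ?_, fun n => (g' n).2.2,
    fun n => ?_, ?_⟩
  · simp only [hg']; exact hn1 _
  · simp only [hg']; exact hn2 _
  · have hy := (nx ⟨x0, hx0, hx0X⟩).2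
    have hy1 := hn1 ⟨x0, hx0, hx0X⟩
    have hy2 := hn2 ⟨x0, hx0, hx0X⟩
    set y := (nx ⟨x0, hx0, hx0X⟩).1
    obtain ⟨z, ⟨h1, h2⟩, h3⟩ := (((hv x0).and (hv y)).and (hUT y)).exists
    have := prd_mul m hy1.le h3.le
    rw [h1, h2, hy2, hx0, hy.1] at this
    exact this

/-- The pair `(s, e)` occurs infinitely often. -/
def Occ (u : ℕ → M) (s e : M) : Prop :=
  ∀ N, ∃ x ≥ N, ∃ y ≥ x, prd u 0 x = s ∧ prd u x y = e

/-- Transition function of the automaton for `Occ`. -/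
def occStep (s e : M) (x : M × Set M) (a : M) : M × Set M :=
  (x.1 * a, {m | (m = 1 ∧ x.1 * a = s) ∨ (e ∉ x.2 ∧ ∃ m' ∈ x.2, m = m' * a)})

lemma reg_occ [Finite M] (s e : M) : Reg {u : Word M | Occ u s e} := by
  refine ⟨M × Set M, inferInstance, (1, {m | m = 1 ∧ 1 = s}), occStep s e,
    fun S => ∃ x ∈ S, e ∈ x.2, fun u => ?_⟩
  set ρ := mrun (occStep s e) (1, {m | m = 1 ∧ 1 = s}) u with hρ
  have hfst : ∀ n, (ρ n).1 = prd u 0 n := by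
    intro n
    induction n with
    | zero => rfl
    | succ n ih => rw [prd_succ _ (Nat.zero_le n), ← ih]; rfl
  have hsnd : ∀ n m, m ∈ (ρ (n + 1)).2 ↔ (m = 1 ∧ prd u 0 (n + 1) = s) ∨
      (e ∉ (ρ n).2 ∧ ∃ m' ∈ (ρ n).2, m = m' * u n) := by
    intro n m
    rw [prd_succ _ (Nat.zero_le n), ← hfst]; rfl
  have hA : ∀ n m, m ∈ (ρ n).2 → ∃ x ≤ n, prd u 0 x = s ∧ prd u x n = m ∧
      ∀ k < n, e ∈ (ρ k).2 → k < x := by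
    intro n
    induction n with
    | zero =>
      rintro m ⟨h1, h2⟩
      exact ⟨0, le_rfl, h2, h1.symm, by simp⟩
    | succ n ih =>
      intro m hm
      rw [hsnd] at hm
      rcases hm with ⟨rfl, h⟩ | ⟨he, m', hm', rfl⟩
      · exact ⟨n + 1, le_rfl, h, prd_self _ _, fun k hk _ => hk⟩
      · obtain ⟨x, hx, h1, h2, h3⟩ := ih m' hm'
        refine ⟨x, by omega, h1, by rw [prd_succ _ hx, h2], fun k hk hke => ?_⟩
        rcases Nat.lt_succ_iff_lt_or_eq.1 hk with h | rfl
        · exact h3 k h hke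
        · exact absurd hke he
  have hflag : (∃ x ∈ infOcc ρ, e ∈ x.2) ↔ ∀ N, ∃ n ≥ N, e ∈ (ρ n).2 := by
    constructor
    · rintro ⟨x, hx, he⟩ N
      obtain ⟨n, hn, rfl⟩ := hx N
      exact ⟨n, hn, he⟩
    · exact exists_infOcc ρ (fun x => e ∈ x.2)
  simp only [hflag]
  constructor
  · intro h
    by_contra hc
    push Not at hc
    obtain ⟨N, hN⟩ := hc
    obtain ⟨x, hx, y, hy, h1, h2⟩ := h N
    have : prd u x y ∈ (ρ y).2 := by
      clear h2
      induction y, hy using Nat.le_induction with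
      | base =>
        rw [prd_self]
        cases x with
        | zero => exact ⟨rfl, h1⟩
        | succ x => rw [hsnd]; exact Or.inl ⟨rfl, h1⟩
      | succ y hy ih =>
        rw [hsnd, prd_succ _ hy]
        exact Or.inr ⟨hN y (by omega), _, ih, rfl⟩
    rw [h2] at this
    exact hN y (by omega) this
  · intro h N
    obtain ⟨k, hk, hke⟩ := h N
    obtain ⟨n, hn, hne⟩ := h (k + 1)
    obtain ⟨x, hx, h1, h2, h3⟩ := hA n e hne
    exact ⟨x, by have := h3 k (by omega) hke; omega, n, hx, h1, h2⟩

/-- The sequence `s, e, e, e, …`. -/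
def lasso (s e : M) : ℕ → M
  | 0 => s
  | _ + 1 => e

/-- Invariance of a set of sequences under grouping of factors. -/
def GroupInv (Acc : (ℕ → M) → Prop) : Prop :=
  ∀ (m : ℕ → M) (g : ℕ → ℕ), StrictMono g → g 0 = 0 →
    (Acc m ↔ Acc fun i => prd m (g i) (g (i + 1)))

lemma prd_two (m : ℕ → M) (i : ℕ) : prd m i (i + 2) = m i * m (i + 1) := by
  rw [prd_succ _ (by omega), prd_succ _ le_rfl, prd_self, one_mul]

lemma acc_conj {Acc : (ℕ → M) → Prop} (hA : GroupInv Acc) {s e f : M}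
    (hse : s * e = s) (hef : e * f = f) (hfe : f * e = e) :
    Acc (lasso s f) ↔ Acc (lasso s e) := by
  let m : ℕ → M := fun n => if n = 0 then s else if n % 2 = 1 then e else f
  have h1 := hA m (fun i => 2 * i) (fun a b h => by simp only; omega) rfl
  have h2 := hA m (fun i => 2 * i - 1) (fun a b h => by simp only; omega) rfl
  have e1 : (fun i => prd m (2 * i) (2 * (i + 1))) = lasso s e := by
    funext i
    rw [show 2 * (i + 1) = 2 * i + 2 by ring, prd_two]
    cases i with
    | zero => simp [m, lasso, hse]
    | succ i =>
      have a1 : (2 * (i + 1)) % 2 = 0 := by omega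
      have a2 : (2 * (i + 1) + 1) % 2 = 1 := by omega
      simp [m, lasso, hfe, a2]
  have e2 : (fun i => prd m (2 * i - 1) (2 * (i + 1) - 1)) = lasso s f := by
    funext i
    cases i with
    | zero => simp [m, lasso, prd]
    | succ i =>
      rw [show 2 * (i + 1 + 1) - 1 = (2 * (i + 1) - 1) + 2 by omega, prd_two]
      have a0 : 2 * (i + 1) - 1 = 2 * i + 1 := by omega
      rw [a0]
      have a1 : (2 * i + 1) % 2 = 1 := by omega
      have a2 : (2 * i + 1 + 1) % 2 = 0 := by omega
      simp [m, lasso, hef, a1, a2]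
  rw [e1] at h1
  rw [e2] at h2
  exact h2.symm.trans h1

lemma acc_lasso {Acc : (ℕ → M) → Prop} (hA : GroupInv Acc) (u : ℕ → M) (g : ℕ → ℕ)
    (hg : StrictMono g) (h0 : 0 < g 0) (f : M) (hf : ∀ i, prd u (g i) (g (i + 1)) = f) :
    Acc u ↔ Acc (lasso (prd u 0 (g 0)) f) := by
  let g' : ℕ → ℕ := fun n => Nat.casesOn n 0 g
  rw [hA u g' (strictMono_nat_of_lt_succ fun n => ?_) rfl]
  · have : (fun i => prd u (g' i) (g' (i + 1))) = lasso (prd u 0 (g 0)) f := by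
      funext i
      cases i with
      | zero => rfl
      | succ i => exact hf i
    rw [this]
  · cases n with
    | zero => exact h0
    | succ n => exact hg (Nat.lt_succ_self n)

/-- Linked pairs. -/
def Linked (s e : M) : Prop := e * e = e ∧ s * e = s

lemma acc_key [Finite M] {Acc : (ℕ → M) → Prop} (hA : GroupInv Acc) (u : ℕ → M) (s e : M)
    (hl : Linked s e) (ho : Occ u s e)
    (hmin : ∀ f, Linked s f → Occ u s f → (∃ t, f = e * t) → ∃ t, e = f * t) :
    Acc u ↔ Acc (lasso s e) := by
  obtain ⟨g, f, hg, hgX, hgf, hff⟩ := ramsey u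
    {x | 0 < x ∧ prd u 0 x = s ∧ ∃ y ≥ x, prd u x y = e} (by
      intro N
      obtain ⟨x, hx, y, hy, h1, h2⟩ := ho (N + 1)
      exact ⟨x, by omega, by omega, h1, y, hy, h2⟩)
  have hpow : ∀ k, prd u (g 0) (g (k + 1)) = f := by
    intro k
    induction k with
    | zero => exact hgf 0
    | succ k ih =>
      rw [← prd_mul u (hg.monotone (Nat.zero_le (k + 1))) (hg.monotone (Nat.le_succ (k + 1))),
        ih, hgf, hff]
  have hft : ∃ t, f = e * t := by
    obtain ⟨_, _, y, hy, hye⟩ := hgX 0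
    have h1 : y ≤ g (y + 1) := (Nat.le_succ y).trans (hg.id_le (y + 1))
    exact ⟨prd u y (g (y + 1)), by rw [← hye, prd_mul u hy h1, hpow]⟩
  have hsf : s * f = s := by
    have := prd_mul u (Nat.zero_le (g 0)) (hg.monotone (Nat.zero_le 1))
    rw [(hgX 0).2.1, (hgX 1).2.1, hgf 0] at this
    exact this
  have hof : Occ u s f := fun N =>
    ⟨g N, hg.id_le N, g (N + 1), hg.monotone (Nat.le_succ N), (hgX N).2.1, hgf N⟩
  obtain ⟨t', ht'⟩ := hmin f ⟨hff, hsf⟩ hof hft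
  obtain ⟨t, ht⟩ := hft
  have hef : e * f = f := by rw [ht, ← mul_assoc, hl.1]
  have hfe : f * e = e := by
    conv_lhs => rw [ht', ← mul_assoc, hff]
    exact ht'.symm
  rw [acc_lasso hA u g hg (hgX 0).1 f hgf, (hgX 0).2.1]
  exact acc_conj hA hl.2 hef hfe

lemma exists_min_pair [Finite M] (u : ℕ → M) : ∃ s e, Linked s e ∧ Occ u s e ∧
    ∀ f, Linked s f → Occ u s f → (∃ t, f = e * t) → ∃ t, e = f * t := by
  obtain ⟨g, f, hg, -, hgf, hff⟩ := ramsey u univ (fun N => ⟨N, le_rfl, trivial⟩)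
  have hval : ∀ k, prd u 0 (g (k + 1)) = prd u 0 (g 0) * f := by
    intro k
    induction k with
    | zero => rw [← hgf 0, prd_mul u (Nat.zero_le _) (hg.monotone (Nat.zero_le _))]
    | succ k ih =>
      rw [← prd_mul u (Nat.zero_le (g (k + 1))) (hg.monotone (Nat.le_succ (k + 1))), ih, hgf,
        mul_assoc, hff]
  set s := prd u 0 (g 0) * f with hs
  have hl : Linked s f := ⟨hff, by rw [hs, mul_assoc, hff]⟩
  have hof : Occ u s f := fun N =>
    ⟨g (N + 1), (Nat.le_succ N).trans (hg.id_le (N + 1)), g (N + 1 + 1),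
      hg.monotone (Nat.le_succ (N + 1)), hval N, hgf _⟩
  obtain ⟨e, he, hemin⟩ := Set.exists_min_image {e | Linked s e ∧ Occ u s e}
    (fun e => (Set.range (fun t => e * t)).ncard) (Set.toFinite _) ⟨f, hl, hof⟩
  refine ⟨s, e, he.1, he.2, ?_⟩
  rintro f' h1 h2 ⟨t, rfl⟩
  have hsub : Set.range (fun t' => e * t * t') ⊆ Set.range (fun t => e * t) := by
    rintro _ ⟨x, rfl⟩
    exact ⟨t * x, by simp [mul_assoc]⟩
  have heq := Set.eq_of_subset_of_ncard_le hsub (hemin _ ⟨h1, h2⟩) (Set.toFinite _)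
  have : e ∈ Set.range (fun t => e * t) := ⟨1, mul_one e⟩
  rw [← heq] at this
  obtain ⟨x, hx⟩ := this
  exact ⟨x, hx.symm⟩

lemma reg_acc [Finite M] {Acc : (ℕ → M) → Prop} (hA : GroupInv Acc) :
    Reg {u : Word M | Acc u} := by
  have := reg_bool (fun p : M × M => {u : Word M | Occ u p.1 p.2})
    (fun p => reg_occ p.1 p.2)
    (fun P => ∃ s e, Linked s e ∧ (s, e) ∈ P ∧
      (∀ f, Linked s f → (s, f) ∈ P → (∃ t, f = e * t) → ∃ t, e = f * t) ∧ Acc (lasso s e))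
  convert this using 1
  ext u
  simp only [mem_ofPred_eq]
  constructor
  · intro h
    obtain ⟨s, e, hl, ho, hmin⟩ := exists_min_pair u
    exact ⟨s, e, hl, ho, hmin, (acc_key hA u s e hl ho hmin).1 h⟩
  · rintro ⟨s, e, hl, ho, hmin, h⟩
    exact (acc_key hA u s e hl ho hmin).2 h

end Mon

/-- Profiles: sets of triples (source, visited states, target). -/
structure Prof (Q : Type) where
  rel : Set (Q × Set Q × Q)

lemma Prof.ext' {Q : Type} {a b : Prof Q} (h : ∀ p S q, (p, S, q) ∈ a.rel ↔ (p, S, q) ∈ b.rel) :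
    a = b := by
  cases a; cases b
  congr 1
  ext ⟨p, S, q⟩
  exact h p S q

instance {Q : Type} [Finite Q] : Finite (Prof Q) :=
  Finite.of_injective Prof.rel (fun a b h => by cases a; cases b; congr)

instance {Q : Type} : Monoid (Prof Q) where
  one := ⟨{x | x.2.1 = ∅ ∧ x.1 = x.2.2}⟩
  mul a b := ⟨{x | ∃ r S T, (x.1, S, r) ∈ a.rel ∧ (r, T, x.2.2) ∈ b.rel ∧ x.2.1 = S ∪ T}⟩
  one_mul a := by
    apply Prof.ext'
    intro p S q
    constructor
    · rintro ⟨r, S', T, ⟨h1, h2⟩, h3, h4⟩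
      simp only at h1 h2 h3 h4
      subst h1 h2 h4
      simpa using h3
    · intro h
      exact ⟨p, ∅, S, ⟨rfl, rfl⟩, h, by simp⟩
  mul_one a := by
    apply Prof.ext'
    intro p S q
    constructor
    · rintro ⟨r, S', T, h3, ⟨h1, h2⟩, h4⟩
      simp only at h1 h2 h3 h4
      subst h1 h2 h4
      simpa using h3
    · intro h
      exact ⟨q, S, ∅, h, ⟨rfl, rfl⟩, by simp⟩
  mul_assoc a b c := by
    apply Prof.ext'
    intro p S q
    constructor
    · rintro ⟨r, S', T, ⟨r', S1, T1, h1, h2, h3⟩, h4, h5⟩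
      simp only at h1 h2 h3 h4 h5
      exact ⟨r', S1, T1 ∪ T, h1, ⟨r, T1, T, h2, h4, rfl⟩, by
        simp only; rw [h5, h3, Set.union_assoc]⟩
    · rintro ⟨r, S', T, h4, ⟨r', S1, T1, h1, h2, h3⟩, h5⟩
      simp only at h1 h2 h3 h4 h5
      exact ⟨r', S' ∪ S1, T1, ⟨r, S', S1, h4, h1, rfl⟩, h2, by
        simp only; rw [h5, h3, Set.union_assoc]⟩

lemma Prof.mem_mul {Q : Type} (a b : Prof Q) (p S q) : (p, S, q) ∈ (a * b).rel ↔
    ∃ r S1 T, (p, S1, r) ∈ a.rel ∧ (r, T, q) ∈ b.rel ∧ S = S1 ∪ T := Iff.rfl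

lemma Prof.mem_one {Q : Type} (p : Q) (S q) : (p, S, q) ∈ (1 : Prof Q).rel ↔
    S = ∅ ∧ p = q := Iff.rfl

lemma mem_prd {Q : Type} (m : ℕ → Prof Q) {i j : ℕ} (hij : i ≤ j) (p : Q) (S : Set Q) (q : Q) :
    (p, S, q) ∈ (prd m i j).rel ↔ ∃ (ρ : ℕ → Q) (σ : ℕ → Set Q), ρ i = p ∧ ρ j = q ∧
      (∀ l, i ≤ l → l < j → (ρ l, σ l, ρ (l + 1)) ∈ (m l).rel) ∧
      S = {x | ∃ l, i ≤ l ∧ l < j ∧ x ∈ σ l} := by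
  induction j, hij using Nat.le_induction generalizing S q with
  | base =>
    rw [prd_self, Prof.mem_one]
    constructor
    · rintro ⟨rfl, rfl⟩
      refine ⟨fun _ => p, fun _ => ∅, rfl, rfl, fun l _ _ => by omega, by simp⟩
    · rintro ⟨ρ, σ, rfl, rfl, -, rfl⟩
      refine ⟨?_, rfl⟩
      ext x
      simp only [mem_ofPred_eq, mem_empty_iff_false, iff_false]
      rintro ⟨l, _, _, _⟩
      omega
  | succ j hj ih =>
    rw [prd_succ _ hj, Prof.mem_mul]
    constructor
    · rintro ⟨r, S1, T, h1, h2, rfl⟩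
      obtain ⟨ρ, σ, rfl, rfl, h3, rfl⟩ := (ih _ _).1 h1
      refine ⟨fun l => if l ≤ j then ρ l else q, fun l => if l < j then σ l else T,
        by simp [hj], by simp, ?_, ?_⟩
      · intro l hl hl'
        rcases Nat.lt_succ_iff_lt_or_eq.1 hl' with h | rfl
        · have h4 : l ≤ j := h.le
          have h5 : l + 1 ≤ j := h
          simp only [h, h4, h5, if_true]
          exact h3 l hl h
        · simpa using h2
      · ext x
        constructor
        · rintro (⟨l, a, b, c⟩ | hx)
          · exact ⟨l, a, by omega, by simpa [b] using c⟩
          · exact ⟨j, hj, by omega, by simpa using hx⟩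
        · rintro ⟨l, a, b, c⟩
          by_cases hlj : l < j
          · exact Or.inl ⟨l, a, hlj, by simpa [hlj] using c⟩
          · exact Or.inr (by simpa [hlj] using c)
    · rintro ⟨ρ, σ, rfl, rfl, h3, rfl⟩
      refine ⟨ρ j, {x | ∃ l, i ≤ l ∧ l < j ∧ x ∈ σ l}, σ j, (ih _ _).2
        ⟨ρ, σ, rfl, rfl, fun l a b => h3 l a (by omega), rfl⟩, h3 j hj (by omega), ?_⟩
      ext x
      constructor
      · rintro ⟨l, a, b, c⟩
        rcases Nat.lt_succ_iff_lt_or_eq.1 b with h | rfl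
        · exact Or.inl ⟨l, a, h, c⟩
        · exact Or.inr c
      · rintro (⟨l, a, b, c⟩ | hx)
        · exact ⟨l, a, by omega, c⟩
        · exact ⟨j, hj, by omega, hx⟩

/-- Acceptance of a sequence of profiles. -/
def ProfAcc {Q : Type} (q0 : Q) (F : Set Q → Prop) (m : ℕ → Prof Q) : Prop :=
  ∃ (p : ℕ → Q) (S : ℕ → Set Q), p 0 = q0 ∧ (∀ i, (p i, S i, p (i + 1)) ∈ (m i).rel) ∧
    F {q | ∀ N, ∃ i ≥ N, q ∈ S i}

lemma exists_block {g : ℕ → ℕ} (hg : StrictMono g) (h0 : g 0 = 0) (j : ℕ) :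
    ∃ b, g b ≤ j ∧ j < g (b + 1) := by
  induction j with
  | zero => exact ⟨0, h0.le, by have := hg (Nat.zero_lt_one); simp only [zero_add]; omega⟩
  | succ j ih =>
    obtain ⟨b, h1, h2⟩ := ih
    by_cases h : j + 1 < g (b + 1)
    · exact ⟨b, by omega, h⟩
    · exact ⟨b + 1, by omega, by have := hg (Nat.lt_add_one (b + 1)); omega⟩

lemma block_unique {g : ℕ → ℕ} (hg : StrictMono g) {j b c : ℕ}
    (h1 : g b ≤ j) (h2 : j < g (b + 1)) (h3 : g c ≤ j) (h4 : j < g (c + 1)) : b = c := by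
  have a := hg.lt_iff_lt.1 (h1.trans_lt h4)
  have b := hg.lt_iff_lt.1 (h3.trans_lt h2)
  omega

lemma inf_group {Q : Type} {g : ℕ → ℕ} (hg : StrictMono g) (h0 : g 0 = 0) (σ : ℕ → Set Q) :
    {q | ∀ N, ∃ i ≥ N, q ∈ {x | ∃ l, g i ≤ l ∧ l < g (i + 1) ∧ x ∈ σ l}} =
      {q | ∀ N, ∃ i ≥ N, q ∈ σ i} := by
  ext q
  constructor
  · intro h N
    obtain ⟨i, hi, l, h1, h2, h3⟩ := h N
    exact ⟨l, by have : i ≤ g i := hg.id_le i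
                 omega, h3⟩
  · intro h N
    obtain ⟨l, hl, h1⟩ := h (g N)
    obtain ⟨b, hb1, hb2⟩ := exists_block hg h0 l
    refine ⟨b, ?_, l, hb1, hb2, h1⟩
    have := hg.lt_iff_lt.1 (lt_of_le_of_lt hl hb2)
    omega

lemma profAcc_group {Q : Type} (q0 : Q) (F : Set Q → Prop) : GroupInv (ProfAcc q0 F) := by
  intro m g hg h0
  constructor
  · rintro ⟨p, S, hp, hstep, hF⟩
    refine ⟨fun i => p (g i), fun i => {x | ∃ l, g i ≤ l ∧ l < g (i + 1) ∧ x ∈ S l},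
      by simp [h0, hp], fun i => ?_, ?_⟩
    · rw [mem_prd m (hg.monotone (Nat.le_succ i))]
      exact ⟨p, S, rfl, rfl, fun l _ _ => hstep l, rfl⟩
    · rw [inf_group hg h0]; exact hF
  · rintro ⟨p, S, hp, hstep, hF⟩
    simp only [mem_prd m (hg.monotone (Nat.le_succ _))] at hstep
    choose ρ σ h1 h2 h3 h4 using hstep
    choose b hb1 hb2 using exists_block hg h0
    have hb : ∀ j c, g c ≤ j → j < g (c + 1) → b j = c := fun j c a a' =>
      block_unique hg (hb1 j) (hb2 j) a a'
    refine ⟨fun j => ρ (b j) j, fun j => σ (b j) j, ?_, fun j => ?_, ?_⟩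
    · have : b 0 = 0 := hb 0 0 h0.le (by have := hg (Nat.zero_lt_one); simp only [zero_add]; omega)
      have h5 := h1 0
      rw [h0] at h5
      simp only [this, h5, hp]
    · have h5 := h3 (b j) j (hb1 j) (hb2 j)
      by_cases h : j + 1 < g (b j + 1)
      · have : b (j + 1) = b j := hb _ _ (by have := hb1 j; omega) h
        simp only [this]
        exact h5
      · have h6 : j + 1 = g (b j + 1) := by have := hb2 j; omega
        have h7 : b (j + 1) = b j + 1 :=
          hb _ _ h6.ge (by rw [h6]; exact hg (Nat.lt_succ_self _))
        have h8 : ρ (b (j + 1)) (j + 1) = ρ (b j) (j + 1) := by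
          rw [h7, h6, h1, h2]
        simp only [h8]
        exact h5
    · rw [← inf_group hg h0]
      have : ∀ i, {x | ∃ l, g i ≤ l ∧ l < g (i + 1) ∧ x ∈ σ (b l) l} = S i := by
        intro i
        rw [h4]
        ext x
        constructor
        · rintro ⟨l, a, a', c⟩
          rw [hb l i a a'] at c
          exact ⟨l, a, a', c⟩
        · rintro ⟨l, a, a', c⟩
          exact ⟨l, a, a', by rw [hb l i a a']; exact c⟩
      simp only [this]
      exact hF

lemma reg_proj {A B : Type} (f : A → B) {L : Set (Word A)} (hL : Reg L) :
    Reg {w : Word A | ∃ w' ∈ L, ∀ j, f (w' j) = f (w j)} := by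
  obtain ⟨Q, hQ, q0, step, F, hF⟩ := hL
  have := reg_comap (fun a : A => (⟨{x | x.2.1 = {x.1} ∧
    ∃ a', f a' = f a ∧ step x.1 a' = x.2.2}⟩ : Prof Q)) (reg_acc (profAcc_group q0 F))
  convert this using 1
  ext w
  simp only [mem_ofPred_eq]
  constructor
  · rintro ⟨w', hw', hf⟩
    refine ⟨mrun step q0 w', fun i => {mrun step q0 w' i}, rfl,
      fun i => ⟨rfl, w' i, hf i, rfl⟩, ?_⟩
    rw [hF] at hw'
    convert hw' using 1
    ext q
    simp [infOcc, eq_comm]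
  · rintro ⟨p, S, hp, hstep, h⟩
    choose h1 w' h2 h3 using hstep
    refine ⟨w', ?_, h2⟩
    have hr : mrun step q0 w' = p := by
      funext n
      induction n with
      | zero => exact hp.symm
      | succ n ih => rw [mrun, ih]; exact h3 n
    rw [hF, hr]
    convert h using 1
    ext q
    simp only at h1
    simp [infOcc, h1, eq_comm]

lemma reg_and {A : Type} {L K : Set (Word A)} (hL : Reg L) (hK : Reg K) : Reg (L ∩ K) := by
  have := reg_bool (fun b : Bool => if b then L else K) (by rintro (_ | _) <;> simpa)
    (fun P => true ∈ P ∧ false ∈ P)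
  convert this using 1
  ext w
  simp

lemma reg_diff {A : Type} {L K : Set (Word A)} (hL : Reg L) (hK : Reg K) : Reg (L \ K) := by
  have := reg_bool (fun b : Bool => if b then L else K) (by rintro (_ | _) <;> simpa)
    (fun P => true ∈ P ∧ false ∉ P)
  convert this using 1
  ext w
  simp

/-- there is a DPW accepting exactly the words in `Lφ` in which the
secret is hidden from an observer that knows the specification: both noise-witnesses
must also satisfy `Lφ`. -/
theorem dpw_for_privacy_knowing_spec_exists {I O : Type} [Fintype I] [Fintype O]
    (H : Set (I ⊕ O)) (Lφ Lψ : Set (Word (Set (I ⊕ O))))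
    (hφ : ∃ (Q : Type) (_ : Fintype Q) (D : DPW (Set (I ⊕ O)) Q), D.lang = Lφ)
    (hψ : ∃ (Q : Type) (_ : Fintype Q) (D : DPW (Set (I ⊕ O)) Q), D.lang = Lψ) :
    ∃ (Q : Type) (_ : Fintype Q) (D : DPW (Set (I ⊕ O)) Q),
      D.lang = {w | w ∈ Lφ ∧
        ∃ wp ∈ noiseW H w, ∃ wm ∈ noiseW H w,
          wp ∈ Lφ ∩ Lψ ∧ wm ∈ Lφ \ Lψ} := by
  obtain ⟨Q1, _, D1, rfl⟩ := hφ
  obtain ⟨Q2, _, D2, rfl⟩ := hψ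
  have h1 := reg_of_dpw D1
  have h2 := reg_of_dpw D2
  have h3 := reg_proj (fun a : Set (I ⊕ O) => a ∩ Hᶜ) (reg_and h1 h2)
  have h4 := reg_proj (fun a : Set (I ⊕ O) => a ∩ Hᶜ) (reg_diff h1 h2)
  obtain ⟨Q, hQ, D, hD⟩ := dpw_of_reg (reg_and h1 (reg_and h3 h4))
  refine ⟨Q, hQ, D, ?_⟩
  rw [hD]
  ext w
  constructor
  · rintro ⟨ha, ⟨wp, hp, hp'⟩, ⟨wm, hm, hm'⟩⟩
    exact ⟨ha, wp, hp', wm, hm', hp, hm⟩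
  · rintro ⟨ha, wp, hp', wm, hm', hp, hm⟩
    exact ⟨ha, ⟨wp, hp, hp'⟩, ⟨wm, hm, hm'⟩⟩
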